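/- Let m be a nonnegative integer and for integers k ≥ 1 set g_k(r) = (1/Γ(k+m)) ∫_{r²}^∞ t^{k+m−1} e^{−t} dt, the probability that a Gamma(k+m,1) random variable exceeds r². There exist constants C > 0 and R₀ > 1 such that for all r ≥ R₀, ∏_{k=1}^∞ g_k(r) ≥ exp( −r⁴/4 − (r²/2) log(r²) − r² ( C(m) − m + log(m!) + log 4 ) − C log r ). -/

import Mathlib

open MeasureTheory Real

/-- The second Bernoulli periodic function `P₂(x) = (x-⌊x⌋)² - (x-⌊x⌋) + 1/6`. -/
noncomputable def bernoulliPeriodic₂ (x : ℝ) : ℝ :=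
  Int.fract x ^ 2 - Int.fract x + 1 / 6

/-- The constant `C(m)` appearing in the lower bound for the hole probability. -/
noncomputable def holeConstC (m : ℝ) : ℝ :=
  m + 1 - 1 / (12 * (m + 1)) - (1 / 2 + m) * Real.log (1 + m) +
    (1 / 2) * ∫ x in Set.Ioi (1 : ℝ), bernoulliPeriodic₂ x / (m + x) ^ 2

open Filter Topology

/-! ### The Euler–Maclaurin constant -/

/-- The limiting constant `log √(2π)` in Stirling's formula. -/
noncomputable def stirlingConst : ℝ := Real.log (√π) + Real.log 2 / 2

lemma log_factorial_eq_stirlingSeq {n : ℕ} (hn : 0 < n) :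
    Real.log (n.factorial : ℝ) = (n + 1 / 2) * Real.log n - n
      + Real.log (Stirling.stirlingSeq n) + Real.log 2 / 2 := by
  have hn' : (0 : ℝ) < n := by exact_mod_cast hn
  rw [Stirling.log_stirlingSeq_formula, Real.log_mul two_ne_zero hn'.ne',
    Real.log_div hn'.ne' (Real.exp_pos 1).ne', Real.log_exp]
  ring

lemma tendsto_log_stirlingSeq :
    Tendsto (fun n => Real.log (Stirling.stirlingSeq n)) atTop (𝓝 (Real.log (√π))) :=
  Stirling.tendsto_stirlingSeq_sqrt_pi.log (by positivity)

lemma log_stirlingSeq_le {n : ℕ} (hn : 0 < n) :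
    Real.log (Stirling.stirlingSeq n) ≤ Real.log (√π) + 1 / (12 * n) := by
  have hmono : Monotone fun k : ℕ =>
      Real.log (Stirling.stirlingSeq (k + 1)) - 1 / (12 * ((k : ℝ) + 1)) := by
    refine monotone_nat_of_le_succ fun k => ?_
    have h := Stirling.log_stirlingSeq_sdiff_le (k + 1)
    have e : 1 / (12 * ((k : ℝ) + 1)) - 1 / (12 * ((k : ℝ) + 1 + 1))
        = 1 / (12 * ((k : ℝ) + 1) * ((k : ℝ) + 1 + 1)) := by
      field_simp; ring
    push_cast at h ⊢
    linarith
  have hlim : Tendsto (fun k : ℕ =>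
      Real.log (Stirling.stirlingSeq (k + 1)) - 1 / (12 * ((k : ℝ) + 1))) atTop
      (𝓝 (Real.log (√π) - 1 / 12 * 0)) := by
    refine (tendsto_log_stirlingSeq.comp (tendsto_add_atTop_nat 1)).sub ?_
    refine (tendsto_one_div_add_atTop_nhds_zero_nat (𝕜 := ℝ)).const_mul (1 / 12) |>.congr ?_
    intro k
    field_simp
  obtain ⟨k, rfl⟩ : ∃ k, n = k + 1 := ⟨n - 1, by omega⟩
  have := hmono.ge_of_tendsto hlim k
  push_cast
  linarith

lemma log_factorial_le {n : ℕ} (hn : 0 < n) :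
    Real.log (n.factorial : ℝ)
      ≤ (n + 1 / 2) * Real.log n - n + stirlingConst + 1 / (12 * n) := by
  rw [log_factorial_eq_stirlingSeq hn, stirlingConst]
  linarith [log_stirlingSeq_le hn]

lemma integrableOn_bernoulliPeriodic₂_div (m : ℕ) :
    IntegrableOn (fun x : ℝ => bernoulliPeriodic₂ x / (m + x) ^ 2) (Set.Ioi 1) := by
  refine Integrable.mono' (integrableOn_Ioi_rpow_of_lt (a := -2) (by norm_num) one_pos) ?_ ?_
  · refine Measurable.aestronglyMeasurable ?_
    have : Measurable bernoulliPeriodic₂ :=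
      ((measurable_fract.pow_const 2).sub measurable_fract).add_const _
    exact this.div (by fun_prop)
  · filter_upwards [ae_restrict_mem measurableSet_Ioi] with x hx
    have hx : (1 : ℝ) < x := hx
    have h0 := Int.fract_nonneg x
    have h1 := Int.fract_lt_one x
    have hm : (0 : ℝ) ≤ m := m.cast_nonneg
    have hb : |bernoulliPeriodic₂ x| ≤ 1 := by
      rw [bernoulliPeriodic₂, abs_le]
      constructor <;> nlinarith
    rw [norm_div, Real.norm_eq_abs, Real.norm_eq_abs, abs_of_nonneg (sq_nonneg ((m : ℝ) + x)),
      Real.rpow_neg (by linarith), ← one_div]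
    have : x ^ (2 : ℝ) = x ^ 2 := by exact_mod_cast Real.rpow_natCast x 2
    rw [this]
    gcongr
    linarith

lemma intervalIntegrable_bernoulliPeriodic₂_div (m : ℕ) {a b : ℝ} (ha : 1 ≤ a) (hab : a ≤ b) :
    IntervalIntegrable (fun x : ℝ => bernoulliPeriodic₂ x / (m + x) ^ 2) volume a b := by
  rw [intervalIntegrable_iff_integrableOn_Ioc_of_le hab]
  exact (integrableOn_bernoulliPeriodic₂_div m).mono_set fun x hx => lt_of_le_of_lt ha hx.1

lemma integral_bernoulliPeriodic₂_div_unit (m k : ℕ) (hk : 1 ≤ k) :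
    ∫ x in (k : ℝ)..(k + 1 : ℝ), bernoulliPeriodic₂ x / (m + x) ^ 2
      = 2 - (2 * ((m : ℝ) + k) + 1) * (Real.log (m + k + 1) - Real.log (m + k))
        + (1 / 6) * (1 / ((m : ℝ) + k) - 1 / (m + k + 1)) := by
  have hk' : (1 : ℝ) ≤ k := by exact_mod_cast hk
  have hm : (0 : ℝ) ≤ m := m.cast_nonneg
  set a : ℝ := m + k with ha
  have hpos : ∀ x : ℝ, (k : ℝ) ≤ x → (m : ℝ) + x ≠ 0 := fun x hx => by linarith
  have hfund := intervalIntegral.integral_eq_sub_of_hasDerivAt_of_le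
    (f := fun x : ℝ => (m + x) - (2 * a + 1) * Real.log (m + x) - (a ^ 2 + a + 1 / 6) / (m + x))
    (f' := fun x : ℝ => bernoulliPeriodic₂ x / (m + x) ^ 2) (a := (k : ℝ)) (b := k + 1)
    (by linarith) ?_ ?_ (intervalIntegrable_bernoulliPeriodic₂_div m hk' (by linarith))
  · rw [hfund]
    have e1 : (m : ℝ) + (k + 1) = a + 1 := by rw [ha]; ring
    rw [e1, ← ha]
    have h1 : a ≠ 0 := by linarith
    have h2 : a + 1 ≠ 0 := by linarith
    field_simp
    ring
  · have hc : ContinuousOn (fun x : ℝ => (m : ℝ) + x) (Set.Icc (k : ℝ) (k + 1)) := by fun_prop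
    have hne : ∀ x ∈ Set.Icc (k : ℝ) (k + 1), (m : ℝ) + x ≠ 0 := fun x hx => hpos x hx.1
    exact (hc.sub ((hc.log hne).const_mul _)).sub (continuousOn_const.div hc hne)
  · intro x hx
    have hx0 := hpos x hx.1.le
    have hd : HasDerivAt (fun x : ℝ => (m : ℝ) + x) 1 x := (hasDerivAt_id x).const_add _
    have hfr : Int.fract x = x - k := by
      rw [Int.fract_eq_iff]
      exact ⟨by linarith [hx.1], by linarith [hx.2], k, by push_cast; ring⟩
    refine ((hd.sub ((hd.log hx0).const_mul (2 * a + 1))).sub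
      ((hasDerivAt_const x (a ^ 2 + a + 1 / 6)).div hd hx0)).congr_deriv ?_
    simp only [bernoulliPeriodic₂, hfr, ha]
    field_simp
    ring

lemma half_integral_bernoulliPeriodic₂_div (m N : ℕ) :
    (1 / 2) * ∫ x in (1 : ℝ)..((N : ℝ) + 1), bernoulliPeriodic₂ x / (m + x) ^ 2
      = Real.log (Stirling.stirlingSeq (m + 1 + N)) - Real.log (Stirling.stirlingSeq (m + 1))
        + (1 / 12) * (1 / ((m : ℝ) + 1) - 1 / (m + 1 + N)) := by
  induction N with
  | zero => simp
  | succ N ih =>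
    have hN : (0 : ℝ) ≤ N := N.cast_nonneg
    rw [← intervalIntegral.integral_add_adjacent_intervals (b := (N : ℝ) + 1)
      (intervalIntegrable_bernoulliPeriodic₂_div m le_rfl (by linarith))
      (intervalIntegrable_bernoulliPeriodic₂_div m (by linarith) (by push_cast; linarith)),
      mul_add, ih]
    have h := integral_bernoulliPeriodic₂_div_unit m (N + 1) (by omega)
    have s1 := log_factorial_eq_stirlingSeq (n := m + 1 + N) (by omega)
    have s2 := log_factorial_eq_stirlingSeq (n := m + 1 + (N + 1)) (by omega)
    rw [show m + 1 + (N + 1) = (m + 1 + N) + 1 by ring, Nat.factorial_succ] at s2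
    have hf : (((m + 1 + N).factorial : ℕ) : ℝ) ≠ 0 := by positivity
    rw [Nat.cast_mul, Real.log_mul (by positivity) hf] at s2
    push_cast at h s1 s2 ⊢
    rw [h]
    rw [show (m : ℝ) + 1 + (N + 1) = m + 1 + N + 1 by ring,
      show (m : ℝ) + (N + 1) = m + 1 + N by ring,
      show m + 1 + (N + 1) = m + 1 + N + 1 by ring]
    linarith

lemma holeConstC_add_log_factorial (m : ℕ) :
    holeConstC (m : ℝ) + Real.log (m.factorial : ℝ) = stirlingConst := by
  have hlim : Tendsto (fun N : ℕ =>
      ∫ x in (1 : ℝ)..((N : ℝ) + 1), bernoulliPeriodic₂ x / (m + x) ^ 2) atTop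
      (𝓝 (∫ x in Set.Ioi (1 : ℝ), bernoulliPeriodic₂ x / (m + x) ^ 2)) :=
    intervalIntegral_tendsto_integral_Ioi 1 (integrableOn_bernoulliPeriodic₂_div m)
      (tendsto_natCast_atTop_atTop.atTop_add tendsto_const_nhds)
  have hlim' : Tendsto (fun N : ℕ =>
      Real.log (Stirling.stirlingSeq (m + 1 + N)) - Real.log (Stirling.stirlingSeq (m + 1))
        + (1 / 12) * (1 / ((m : ℝ) + 1) - 1 / (m + 1 + N))) atTop
      (𝓝 (Real.log (√π) - Real.log (Stirling.stirlingSeq (m + 1))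
        + (1 / 12) * (1 / ((m : ℝ) + 1) - 0))) := by
    refine Tendsto.add (Tendsto.sub ?_ tendsto_const_nhds)
      (Tendsto.const_mul _ (tendsto_const_nhds.sub ?_))
    · exact tendsto_log_stirlingSeq.comp
        (tendsto_atTop_mono (fun n => Nat.le_add_left n (m + 1)) tendsto_id)
    · simp_rw [one_div]
      exact tendsto_inv_atTop_zero.comp
        (tendsto_atTop_add_const_left _ _ tendsto_natCast_atTop_atTop)
  have key := tendsto_nhds_unique
    ((hlim.const_mul (1 / 2)).congr (half_integral_bernoulliPeriodic₂_div m)) hlim'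
  have s := log_factorial_eq_stirlingSeq (n := m + 1) (by omega)
  rw [Nat.factorial_succ, Nat.cast_mul, Real.log_mul (by positivity) (by positivity)] at s
  push_cast at s
  have hm : (0 : ℝ) < m + 1 := by positivity
  rw [holeConstC, key, stirlingConst, add_comm (1 : ℝ) (m : ℝ)]
  have e : 1 / (12 * ((m : ℝ) + 1)) = 1 / 12 * (1 / ((m : ℝ) + 1) - 0) := by
    field_simp; ring
  rw [e]
  linarith

/-! ### Gamma tail probabilities -/

/-- The probability that a `Gamma(j + 1, 1)` variable exceeds `R`. -/
noncomputable def gammaTail (j : ℕ) (R : ℝ) : ℝ :=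
  (1 / (j.factorial : ℝ)) * ∫ t in Set.Ioi R, t ^ j * Real.exp (-t)

lemma integrableOn_pow_mul_exp_neg (j : ℕ) :
    IntegrableOn (fun t : ℝ => t ^ j * Real.exp (-t)) (Set.Ioi 0) := by
  have h := Real.GammaIntegral_convergent (s := (j : ℝ) + 1) (by positivity)
  refine h.congr_fun (fun t _ => ?_) measurableSet_Ioi
  simp [mul_comm]

lemma integral_pow_mul_exp_neg (j : ℕ) :
    ∫ t in Set.Ioi (0 : ℝ), t ^ j * Real.exp (-t) = j.factorial := by
  rw [← Real.Gamma_nat_eq_factorial, Real.Gamma_eq_integral (by positivity)]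
  refine setIntegral_congr_fun measurableSet_Ioi fun t _ => ?_
  simp [mul_comm]

lemma gammaTail_le_one (j : ℕ) {R : ℝ} (hR : 0 ≤ R) : gammaTail j R ≤ 1 := by
  have hj : (0 : ℝ) < j.factorial := by positivity
  rw [gammaTail, one_div, inv_mul_le_iff₀ hj, mul_one, ← integral_pow_mul_exp_neg]
  refine setIntegral_mono_set (integrableOn_pow_mul_exp_neg j) ?_
    (Set.Ioi_subset_Ioi hR).eventuallyLE
  filter_upwards [ae_restrict_mem measurableSet_Ioi] with t ht
  have ht : (0 : ℝ) < t := ht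
  simp only [Pi.zero_apply]
  positivity

lemma exp_neg_mul_pow_div_factorial_le_gammaTail (j : ℕ) {R : ℝ} (hR : 0 ≤ R) :
    Real.exp (-R) * R ^ j / j.factorial ≤ gammaTail j R := by
  have hj : (0 : ℝ) < j.factorial := by positivity
  have hint : IntegrableOn (fun t : ℝ => Real.exp (-t)) (Set.Ioi R) := by
    simpa using (integrableOn_pow_mul_exp_neg 0).mono_set (Set.Ioi_subset_Ioi hR)
  have h : R ^ j * Real.exp (-R) ≤ ∫ t in Set.Ioi R, t ^ j * Real.exp (-t) := by
    rw [← integral_exp_neg_Ioi R, ← integral_const_mul]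
    refine setIntegral_mono_on (hint.const_mul _)
      ((integrableOn_pow_mul_exp_neg j).mono_set (Set.Ioi_subset_Ioi hR)) measurableSet_Ioi ?_
    intro t ht
    have ht : R < t := ht
    gcongr
  rw [gammaTail, one_div, ← div_eq_inv_mul]
  gcongr
  linarith

/-- Markov's inequality for the negative second moment of a Gamma variable. -/
lemma one_sub_sq_div_le_gammaTail (j : ℕ) {R : ℝ} (hR : 0 ≤ R) :
    1 - R ^ 2 / (((j : ℝ) + 2) * (j + 1)) ≤ gammaTail (j + 2) R := by
  have hj : (0 : ℝ) < (j + 2).factorial := by positivity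
  have hsplit : ((j + 2).factorial : ℝ) = (∫ t in Set.Ioc (0 : ℝ) R, t ^ (j + 2) * Real.exp (-t))
      + ∫ t in Set.Ioi R, t ^ (j + 2) * Real.exp (-t) := by
    rw [← integral_pow_mul_exp_neg, ← Set.Ioc_union_Ioi_eq_Ioi hR]
    exact setIntegral_union (Set.Ioc_disjoint_Ioi le_rfl) measurableSet_Ioi
      ((integrableOn_pow_mul_exp_neg _).mono_set Set.Ioc_subset_Ioi_self)
      ((integrableOn_pow_mul_exp_neg _).mono_set (Set.Ioi_subset_Ioi hR))
  have hlow : ∫ t in Set.Ioc (0 : ℝ) R, t ^ (j + 2) * Real.exp (-t) ≤ R ^ 2 * j.factorial := by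
    rw [← integral_pow_mul_exp_neg j, ← integral_const_mul]
    calc _ ≤ ∫ t in Set.Ioc (0 : ℝ) R, R ^ 2 * (t ^ j * Real.exp (-t)) := by
          refine setIntegral_mono_on
            ((integrableOn_pow_mul_exp_neg _).mono_set Set.Ioc_subset_Ioi_self)
            (((integrableOn_pow_mul_exp_neg _).mono_set Set.Ioc_subset_Ioi_self).const_mul _)
            measurableSet_Ioc ?_
          intro t ht
          have h0 : (0 : ℝ) < t := ht.1
          have h1 : t ≤ R := ht.2
          rw [pow_add, mul_comm (t ^ j), mul_assoc]
          gcongr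
      _ ≤ _ := by
          refine setIntegral_mono_set ((integrableOn_pow_mul_exp_neg j).const_mul _) ?_
            (Set.Ioc_subset_Ioi_self).eventuallyLE
          filter_upwards [ae_restrict_mem measurableSet_Ioi] with t ht
          have ht : (0 : ℝ) < t := ht
          simp only [Pi.zero_apply]
          positivity
  have hfac : ((j + 2).factorial : ℝ) = ((j : ℝ) + 2) * (j + 1) * j.factorial := by
    rw [Nat.factorial_succ, Nat.factorial_succ]
    push_cast
    ring
  have hj0 : (0 : ℝ) < j.factorial := by positivity
  rw [gammaTail, one_div, ← div_eq_inv_mul, le_div_iff₀ hj]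
  have e : (1 - R ^ 2 / (((j : ℝ) + 2) * (j + 1))) * (j + 2).factorial
      = (j + 2).factorial - R ^ 2 * j.factorial := by
    rw [hfac]
    field_simp
  rw [e]
  linarith

lemma multipliable_gammaTail (m : ℕ) {R : ℝ} (hR : 0 ≤ R) :
    Multipliable fun k : ℕ => gammaTail (k + m) R := by
  have hs : Summable fun k : ℕ => gammaTail (k + m) R - 1 := by
    rw [← summable_nat_add_iff 2]
    have hb : Summable fun k : ℕ => R ^ 2 * (1 / ((k : ℝ) + 1) ^ 2) := by
      refine Summable.mul_left _ ?_
      have := (summable_nat_add_iff 1).2 (Real.summable_one_div_nat_pow.2 (by norm_num : 1 < 2))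
      simpa using this
    refine Summable.of_norm_bounded hb fun k => ?_
    have h1 := one_sub_sq_div_le_gammaTail (k + m) hR
    have h2 := gammaTail_le_one (k + 2 + m) hR
    rw [show k + 2 + m = k + m + 2 by ring] at h2 ⊢
    rw [Real.norm_eq_abs, abs_of_nonpos (by linarith)]
    have h3 : R ^ 2 / (((k + m : ℕ) + 2 : ℝ) * ((k + m : ℕ) + 1))
        ≤ R ^ 2 * (1 / ((k : ℝ) + 1) ^ 2) := by
      rw [mul_one_div, sq ((k : ℝ) + 1)]
      have hm : (0 : ℝ) ≤ m := m.cast_nonneg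
      push_cast
      gcongr <;> linarith
    linarith
  simpa using Real.multipliable_one_add_of_summable hs

/-! ### The far factors -/

lemma factorial_mul_factorial_le (A L : ℕ) :
    (A + L).factorial * (A + 1 + L).factorial ≤ L.factorial * (2 * A + 1 + L).factorial := by
  induction A with
  | zero => simp
  | succ A ih =>
    have e1 : (A + 1 + L).factorial = (A + L + 1) * (A + L).factorial := by
      rw [← Nat.factorial_succ]; congr 1; ring
    have e2 : (A + 1 + 1 + L).factorial = (A + L + 2) * (A + 1 + L).factorial := by
      rw [show A + 1 + 1 + L = (A + 1 + L) + 1 by ring, Nat.factorial_succ]; ring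
    have e3 : (2 * (A + 1) + 1 + L).factorial
        = (2 * A + L + 3) * ((2 * A + L + 2) * (2 * A + 1 + L).factorial) := by
      rw [show 2 * (A + 1) + 1 + L = (2 * A + 1 + L) + 1 + 1 by ring, Nat.factorial_succ,
        Nat.factorial_succ]; ring
    rw [e2, e3]
    calc (A + 1 + L).factorial * ((A + L + 2) * (A + 1 + L).factorial)
        = (A + L + 1) * (A + L + 2) * ((A + L).factorial * (A + 1 + L).factorial) := by
          nth_rewrite 1 [e1]; ring
      _ ≤ (2 * A + L + 2) * (2 * A + L + 3) * (L.factorial * (2 * A + 1 + L).factorial) := by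
          gcongr <;> omega
      _ = _ := by ring

lemma prod_far_eq (A L : ℕ) :
    (∏ i ∈ Finset.range L, (((i : ℝ) + 1) * (2 * A + 2 + i) / ((A + 1 + i) * (A + 2 + i))))
        * ((2 * A + 1).choose A)
      = (L.factorial * (2 * A + 1 + L).factorial : ℝ)
          / ((A + L).factorial * (A + 1 + L).factorial) := by
  induction L with
  | zero =>
    have h := Nat.add_choose A (A + 1)
    rw [show A + (A + 1) = 2 * A + 1 by ring, Nat.choose_symm_half] at h
    rw [h, Nat.cast_div]
    · simp
    · have := Nat.factorial_mul_factorial_dvd_factorial_add A (A + 1)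
      rwa [show A + (A + 1) = 2 * A + 1 by ring] at this
    · positivity
  | succ L ih =>
    rw [Finset.prod_range_succ, mul_right_comm, ih]
    rw [← add_assoc, ← add_assoc, ← add_assoc, Nat.factorial_succ, Nat.factorial_succ,
      Nat.factorial_succ, Nat.factorial_succ]
    push_cast
    have h1 : ((A + L).factorial : ℝ) ≠ 0 := by positivity
    have h2 : ((A + 1 + L).factorial : ℝ) ≠ 0 := by positivity
    have h3 : (A : ℝ) + 1 + L ≠ 0 := by positivity
    have h4 : (A : ℝ) + L + 1 ≠ 0 := by positivity
    have h5 : (A : ℝ) + 2 + L ≠ 0 := by positivity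
    have h6 : (A : ℝ) + 1 + L + 1 ≠ 0 := by positivity
    field_simp
    ring

lemma inv_four_pow_le_prod_far (A L : ℕ) :
    ((4 : ℝ) ^ A)⁻¹
      ≤ ∏ i ∈ Finset.range L, (((i : ℝ) + 1) * (2 * A + 2 + i) / ((A + 1 + i) * (A + 2 + i))) := by
  set P := ∏ i ∈ Finset.range L, (((i : ℝ) + 1) * (2 * A + 2 + i) / ((A + 1 + i) * (A + 2 + i)))
  have hP : 0 ≤ P := Finset.prod_nonneg fun i _ => by positivity
  have hc : (((2 * A + 1).choose A : ℕ) : ℝ) ≤ 4 ^ A := by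
    exact_mod_cast Nat.choose_middle_le_pow A
  have h1 : 1 ≤ P * ((2 * A + 1).choose A) := by
    rw [prod_far_eq, one_le_div (by positivity)]
    exact_mod_cast factorial_mul_factorial_le A L
  rw [inv_le_iff_one_le_mul₀ (by positivity)]
  calc 1 ≤ P * ((2 * A + 1).choose A) := h1
    _ ≤ P * 4 ^ A := by gcongr

lemma inv_four_pow_le_prod_gammaTail (A L : ℕ) {R : ℝ} (hR : 0 ≤ R) (hA : R ≤ A) :
    ((4 : ℝ) ^ A)⁻¹ ≤ ∏ i ∈ Finset.range L, gammaTail (A + 2 + i) R := by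
  refine (inv_four_pow_le_prod_far A L).trans (Finset.prod_le_prod (fun i _ => by positivity) ?_)
  intro i _
  have h := one_sub_sq_div_le_gammaTail (A + i) hR
  rw [show A + 2 + i = A + i + 2 by ring]
  refine le_trans ?_ h
  push_cast
  rw [div_le_iff₀ (by positivity), sub_mul, one_mul]
  have e : R ^ 2 / (((A : ℝ) + i + 2) * (A + i + 1)) * ((A + 1 + i) * (A + 2 + i)) = R ^ 2 := by
    field_simp
    ring
  rw [e]
  nlinarith

/-! ### The near factors -/

lemma sum_log_factorial_le {N : ℕ} (hN : 1 ≤ N) :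
    ∑ j ∈ Finset.range N, Real.log (j.factorial : ℝ)
      ≤ (N : ℝ) ^ 2 / 2 * Real.log N - 3 * (N : ℝ) ^ 2 / 4 + stirlingConst * N + Real.log N
        + (3 / 4 + |stirlingConst|) := by
  induction N, hN using Nat.le_induction with
  | base =>
    simp
    linarith [neg_abs_le stirlingConst]
  | succ N hN ih =>
    rw [Finset.sum_range_succ]
    have hN0 : (1 : ℝ) ≤ N := by exact_mod_cast hN
    have hs := log_factorial_le (n := N) hN
    have hl := Real.le_log_one_add_of_nonneg (x := 1 / (N : ℝ)) (by positivity)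
    have e : 1 + 1 / (N : ℝ) = (N + 1) / N := by field_simp
    rw [e, Real.log_div (by positivity) (by positivity)] at hl
    have e2 : 2 * (1 / (N : ℝ)) / (1 / N + 2) = 2 / (2 * N + 1) := by field_simp; ring
    rw [e2] at hl
    have h1 : ((N : ℝ) + 1) ^ 2 / 2 * (2 / (2 * N + 1))
        ≤ (N + 1) ^ 2 / 2 * (Real.log (N + 1) - Real.log N) := by gcongr
    have h2 : (N : ℝ) / 2 + 3 / 4 ≤ ((N : ℝ) + 1) ^ 2 / 2 * (2 / (2 * N + 1)) := by
      field_simp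
      nlinarith
    have h3 : 1 / (12 * (N : ℝ)) ≤ 2 / (2 * N + 1) := by
      rw [div_le_div_iff₀ (by positivity) (by positivity)]
      linarith
    push_cast
    nlinarith

lemma sum_log_weight_lower_bound {R N : ℝ} (hR : 9 ≤ R) (h2 : R + 2 ≤ N) (h3 : N ≤ R + 3) :
    -R ^ 2 / 4 - R / 2 * Real.log R - stirlingConst * R
        - (30 + 4 * |stirlingConst| + 3 * Real.log R)
      ≤ -R * N + N * (N - 1) / 2 * Real.log R
        - (N ^ 2 / 2 * Real.log N - 3 * N ^ 2 / 4 + stirlingConst * N + Real.log N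
          + (3 / 4 + |stirlingConst|)) := by
  have hR0 : 0 < R := by linarith
  have hN0 : 0 < N := by linarith
  obtain ⟨d, rfl⟩ : ∃ d, N = R + d := ⟨N - R, by ring⟩
  have hd2 : 2 ≤ d := by linarith
  have hd3 : d ≤ 3 := by linarith
  have hlogR : 0 ≤ Real.log R := Real.log_nonneg (by linarith)
  have hlog : Real.log (R + d) ≤ Real.log R + d / R := by
    have h := Real.log_le_sub_one_of_pos (x := (R + d) / R) (by positivity)
    rw [Real.log_div hN0.ne' hR0.ne'] at h
    have e : (R + d) / R - 1 = d / R := by field_simp; ring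
    linarith
  have hdR : d / R ≤ 1 / 3 := by
    rw [div_le_div_iff₀ hR0 (by norm_num)]
    linarith
  have hmul : (R + d) ^ 2 / 2 * Real.log (R + d)
      ≤ (R + d) ^ 2 / 2 * Real.log R + (d * R / 2 + d ^ 2 + d ^ 2 / 2 * (d / R)) := by
    have h : (R + d) ^ 2 / 2 * Real.log (R + d)
      ≤ (R + d) ^ 2 / 2 * (Real.log R + d / R) := by gcongr
    refine h.trans (le_of_eq ?_)
    field_simp
    ring
  have hq : d ^ 2 / 2 * (d / R) ≤ 9 / 2 * (1 / 3) := by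
    gcongr
    nlinarith
  have hK : stirlingConst * d ≤ 3 * |stirlingConst| := by
    calc stirlingConst * d ≤ |stirlingConst| * d := by gcongr; exact le_abs_self _
      _ ≤ |stirlingConst| * 3 := by gcongr
      _ = _ := by ring
  have hdl : d * Real.log R ≤ 3 * Real.log R := by gcongr
  nlinarith

lemma log_weight_eq (j : ℕ) {R : ℝ} (hR : 0 < R) :
    Real.exp (-R + j * Real.log R - Real.log (j.factorial : ℝ))
      = Real.exp (-R) * R ^ j / j.factorial := by
  rw [Real.exp_sub, Real.exp_add, Real.exp_log (by positivity), ← Real.log_pow,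
    Real.exp_log (by positivity)]

lemma exp_le_prod_near (m n : ℕ) {R : ℝ} (hR : 9 ≤ R) (hmn : 1 ≤ m + n)
    (h2 : R + 2 ≤ ((m + n : ℕ) : ℝ)) (h3 : ((m + n : ℕ) : ℝ) ≤ R + 3) :
    Real.exp (-R ^ 2 / 4 - R / 2 * Real.log R - stirlingConst * R
        - (30 + 4 * |stirlingConst| + 3 * Real.log R) + m * R - m ^ 2 * Real.log R)
      ≤ ∏ k ∈ Finset.range n, gammaTail (m + k) R := by
  have hR0 : 0 < R := by linarith
  have hlogR : 0 ≤ Real.log R := Real.log_nonneg (by linarith)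
  set a : ℕ → ℝ := fun j => -R + j * Real.log R - Real.log (j.factorial : ℝ) with ha
  have hprod : Real.exp (∑ k ∈ Finset.range n, a (m + k))
      ≤ ∏ k ∈ Finset.range n, gammaTail (m + k) R := by
    rw [Real.exp_sum]
    refine Finset.prod_le_prod (fun _ _ => (Real.exp_pos _).le) fun k _ => ?_
    rw [ha]
    simp only
    rw [log_weight_eq _ hR0]
    exact exp_neg_mul_pow_div_factorial_le_gammaTail _ hR0.le
  refine le_trans (Real.exp_le_exp.2 ?_) hprod
  have hsplit := Finset.sum_range_add a m n
  have hsmall : ∑ j ∈ Finset.range m, a j ≤ -m * R + m ^ 2 * Real.log R := by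
    have : ∑ j ∈ Finset.range m, a j ≤ ∑ _j ∈ Finset.range m, (-R + m * Real.log R) := by
      refine Finset.sum_le_sum fun j hj => ?_
      have hjm : (j : ℝ) ≤ m := by exact_mod_cast (Finset.mem_range.1 hj).le
      have h1 : 0 ≤ Real.log (j.factorial : ℝ) :=
        Real.log_nonneg (by exact_mod_cast Nat.one_le_iff_ne_zero.2 j.factorial_ne_zero)
      have h2 : j * Real.log R ≤ m * Real.log R := by gcongr
      simp only [ha]
      linarith
    refine this.trans (le_of_eq ?_)
    rw [Finset.sum_const, Finset.card_range, nsmul_eq_mul]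
    ring
  have htotal : ∑ j ∈ Finset.range (m + n), a j
      = -R * (m + n : ℕ) + ((m + n : ℕ) : ℝ) * ((m + n : ℕ) - 1) / 2 * Real.log R
        - ∑ j ∈ Finset.range (m + n), Real.log (j.factorial : ℝ) := by
    simp only [ha]
    rw [Finset.sum_sub_distrib, Finset.sum_add_distrib, Finset.sum_const, Finset.card_range,
      nsmul_eq_mul, ← Finset.sum_mul, ← Nat.cast_sum, Finset.sum_range_id,
      Nat.cast_div (even_iff_two_dvd.1 (Nat.even_mul_pred_self _)) two_ne_zero,
      Nat.cast_mul, Nat.cast_sub hmn]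
    push_cast
    ring
  have hw := sum_log_weight_lower_bound hR h2 h3
  have hF := sum_log_factorial_le hmn
  linarith

lemma exp_le_tprod_gammaTail (m : ℕ) {R : ℝ} (hR : 9 ≤ R) (hmR : (m : ℝ) ≤ R) :
    Real.exp (-R ^ 2 / 4 - R / 2 * Real.log R - R * (stirlingConst - m + Real.log 4)
        - (30 + 4 * |stirlingConst| + Real.log 4 + (3 + m ^ 2) * Real.log R))
      ≤ ∏' k : ℕ, gammaTail (k + m) R := by
  have hR0 : 0 ≤ R := by linarith
  set A := ⌈R⌉₊ with hAdef
  have hA1 : R ≤ A := Nat.le_ceil R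
  have hA2 : (A : ℝ) < R + 1 := Nat.ceil_lt_add_one hR0
  have hmA : m ≤ A := by exact_mod_cast hmR.trans hA1
  obtain ⟨n, hn⟩ : ∃ n, A + 2 = m + n := ⟨A + 2 - m, by omega⟩
  have hcast : ((m + n : ℕ) : ℝ) = A + 2 := by rw [← hn]; push_cast; ring
  have hnear := exp_le_prod_near m n hR (by omega) (by rw [hcast]; linarith)
    (by rw [hcast]; linarith)
  have hfour : Real.exp (-(R + 1) * Real.log 4) ≤ ((4 : ℝ) ^ A)⁻¹ := by
    have h4 : (0 : ℝ) ≤ Real.log 4 := Real.log_nonneg (by norm_num)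
    rw [← Real.exp_log (show (0 : ℝ) < ((4 : ℝ) ^ A)⁻¹ by positivity), Real.exp_le_exp,
      Real.log_inv, Real.log_pow]
    nlinarith
  refine ge_of_tendsto (multipliable_gammaTail m hR0).hasProd.tendsto_prod_nat
    (eventually_atTop.2 ⟨n, fun K hK => ?_⟩)
  obtain ⟨L, rfl⟩ := Nat.exists_eq_add_of_le hK
  have hfar := inv_four_pow_le_prod_gammaTail A L hR0 hA1
  rw [Finset.prod_range_add]
  have e1 : ∏ k ∈ Finset.range n, gammaTail (k + m) R
      = ∏ k ∈ Finset.range n, gammaTail (m + k) R := by simp_rw [add_comm]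
  have e2 : ∏ i ∈ Finset.range L, gammaTail (n + i + m) R
      = ∏ i ∈ Finset.range L, gammaTail (A + 2 + i) R := by
    refine Finset.prod_congr rfl fun i _ => ?_
    rw [hn]
    congr 1
    ring
  rw [e1, e2]
  refine le_trans (le_of_eq ?_) (mul_le_mul hnear (hfour.trans hfar) (Real.exp_pos _).le
    ((Real.exp_pos _).le.trans hnear))
  rw [← Real.exp_add]
  congr 1
  ring

/-- Lower bound for the hole probability of the induced infinite Ginibre ensemble of a
single matrix with parameter `m`: with `g_k(r)` the probability that a `Gamma(k+m,1)`
variable exceeds `r²`, one has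
`∏_{k=1}^∞ g_k(r) ≥ exp(-r⁴/4 - (r²/2) log r² - r²(C(m) - m + log m! + log 4) + O(log r))`. -/
theorem gamma_hole_probability_lower_bound
    (m : ℕ)
    (g : ℕ → ℝ → ℝ)
    (hg : ∀ (k : ℕ) (r : ℝ), g k r =
      (1 / Real.Gamma ((k : ℝ) + (m : ℝ))) *
        ∫ t in Set.Ioi (r ^ 2), t ^ (k + m - 1) * Real.exp (-t)) :
    ∃ C > 0, ∃ R₀ > 1, ∀ r ≥ R₀,
      Real.exp (-r ^ 4 / 4 - r ^ 2 / 2 * Real.log (r ^ 2)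
          - r ^ 2 * (holeConstC (m : ℝ) - (m : ℝ)
              + Real.log (m.factorial : ℝ) + Real.log 4)
          - C * Real.log r)
        ≤ ∏' k : ℕ, g (k + 1) r := by
  have hgt : ∀ (k : ℕ) (r : ℝ), g (k + 1) r = gammaTail (k + m) (r ^ 2) := by
    intro k r
    rw [hg, gammaTail, ← Real.Gamma_nat_eq_factorial, show k + 1 + m - 1 = k + m by omega]
    push_cast
    rw [show (k : ℝ) + 1 + m = k + m + 1 by ring]
  set B : ℝ := 30 + 4 * |stirlingConst| + Real.log 4 with hB
  have hB0 : 0 < B := by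
    have : (0 : ℝ) ≤ Real.log 4 := Real.log_nonneg (by norm_num)
    positivity
  refine ⟨B + 2 * (3 + (m : ℝ) ^ 2), by positivity, (m : ℝ) + 3,
    by linarith [m.cast_nonneg (α := ℝ)], fun r hr => ?_⟩
  have hm : (0 : ℝ) ≤ m := m.cast_nonneg
  have hr3 : 3 ≤ r := by linarith
  have hlog : 1 ≤ Real.log r := by
    rw [Real.le_log_iff_exp_le (by linarith)]
    linarith [Real.exp_one_lt_d9]
  have hlog2 : Real.log (r ^ 2) = 2 * Real.log r := by
    rw [Real.log_pow]
    norm_num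
  simp_rw [hgt]
  refine le_trans (Real.exp_le_exp.2 ?_)
    (exp_le_tprod_gammaTail m (R := r ^ 2) (by nlinarith) (by nlinarith))
  have hK : holeConstC (m : ℝ) = stirlingConst - Real.log (m.factorial : ℝ) :=
    eq_sub_of_add_eq (holeConstC_add_log_factorial m)
  have hBl : B ≤ B * Real.log r := le_mul_of_one_le_right hB0.le hlog
  rw [hK, hlog2, ← hB]
  linarith
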